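/- arXiv:2405.06993 — 2 statements merged into one kernel-verified Lean document; each statement's English description precedes it below -/
import Mathlib

section
/- Let E be a real inner product space and let F : E → ℝ be differentiable with gradient ∇F and L-smooth for some L > 0 (i.e. F(v) ≤ F(w) + ⟨∇F(w), v − w⟩ + (L/2)‖v − w‖² for all v, w ∈ E). Suppose F is bounded below: F(w) ≥ F_min for all w ∈ E. Fix reals ε > 0, V ≥ 0 and a step size η > 0 with ηLV² < 2ε. Let x : ℕ → E and d : ℕ → E be sequences such that for every k: x_{k+1} = x_k − η·d_k, ⟨∇F(x_k), d_k⟩ ≥ ε‖∇F(x_k)‖², and ‖d_k‖² ≤ V²‖∇F(x_k)‖². Then for every integer T ≥ 1, (1/T)·∑_{k=0}^{T−1} ‖∇F(x_k)‖² ≤ 2·(F(x_0) − F_min) / (T·η·(2ε − ηLV²)). -/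
open RealInnerProductSpace Finset

/-- One step of `v = w - η u` along an aligned direction `u` of bounded dissimilarity decreases an
`L`-smooth function by a multiple of the squared gradient norm. -/
theorem descent_of_aligned_step
    {E : Type*} [NormedAddCommGroup E] [InnerProductSpace ℝ E]
    {F : E → ℝ} {L ε V η : ℝ} (hL : 0 ≤ L) (hη : 0 ≤ η) {w g u : E}
    (hsmooth : ∀ v : E, F v ≤ F w + ⟪g, v - w⟫ + L / 2 * ‖v - w‖ ^ 2)
    (halign : ε * ‖g‖ ^ 2 ≤ ⟪g, u⟫) (hdis : ‖u‖ ^ 2 ≤ V ^ 2 * ‖g‖ ^ 2) :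
    η * (2 * ε - η * L * V ^ 2) / 2 * ‖g‖ ^ 2 ≤ F w - F (w - η • u) := by
  have h := hsmooth (w - η • u)
  rw [sub_sub_cancel_left, inner_neg_right, norm_neg, inner_smul_right, norm_smul, mul_pow,
    Real.norm_eq_abs, sq_abs] at h
  have h₁ := mul_le_mul_of_nonneg_left halign hη
  have h₂ := mul_le_mul_of_nonneg_left hdis (by positivity : 0 ≤ L / 2 * η ^ 2)
  linarith

/-- Convergence bound (Theorem 5): cumulative mean of squared gradient norms for
the DMS-style iteration `x_{k+1} = x_k - η d_k`. -/
theorem dms_convergence_bound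
    {E : Type*} [NormedAddCommGroup E] [InnerProductSpace ℝ E]
    (F : E → ℝ) (F' : E → E) (L : ℝ) (hL : 0 < L)
    (hdiff : ∀ x : E, HasFDerivAt F (innerSL ℝ (F' x)) x)
    (hsmooth : ∀ v w : E, F v ≤ F w + ⟪F' w, v - w⟫ + L / 2 * ‖v - w‖ ^ 2)
    (Fmin : ℝ) (hbdd : ∀ w : E, Fmin ≤ F w)
    (ε V η : ℝ) (hε : 0 < ε) (hV : 0 ≤ V) (hη : 0 < η)
    (hstep : η * L * V ^ 2 < 2 * ε)
    (x d : ℕ → E)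
    (hx : ∀ k : ℕ, x (k + 1) = x k - η • d k)
    (halign : ∀ k : ℕ, ε * ‖F' (x k)‖ ^ 2 ≤ ⟪F' (x k), d k⟫)
    (hdis : ∀ k : ℕ, ‖d k‖ ^ 2 ≤ V ^ 2 * ‖F' (x k)‖ ^ 2)
    (T : ℕ) (hT : 1 ≤ T) :
    (1 / (T : ℝ)) * ∑ k ∈ Finset.range T, ‖F' (x k)‖ ^ 2 ≤
      2 * (F (x 0) - Fmin) / ((T : ℝ) * η * (2 * ε - η * L * V ^ 2)) := by
  have hc : 0 < 2 * ε - η * L * V ^ 2 := sub_pos.2 hstep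
  have hT' : (0 : ℝ) < T := by exact_mod_cast hT
  have hsum : η * (2 * ε - η * L * V ^ 2) / 2 * ∑ k ∈ Finset.range T, ‖F' (x k)‖ ^ 2 ≤
      F (x 0) - F (x T) := by
    rw [Finset.mul_sum, ← Finset.sum_range_sub' (fun k => F (x k))]
    refine Finset.sum_le_sum fun k _ => ?_
    rw [hx k]
    exact descent_of_aligned_step hL.le hη.le (fun v => hsmooth v (x k)) (halign k) (hdis k)
  have hmin := hbdd (x T)
  rw [one_div, inv_mul_eq_div, mul_assoc, mul_comm (T : ℝ), ← div_div]
  refine div_le_div_of_nonneg_right ?_ hT'.le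
  rw [le_div_iff₀ (mul_pos hη hc)]
  linarith
end

section
/- Let E be a real inner product space and let F : E → ℝ be differentiable with gradient ∇F and L-smooth for some L > 0 (i.e. F(v) ≤ F(w) + ⟨∇F(w), v − w⟩ + (L/2)‖v − w‖² for all v, w ∈ E). Suppose F is bounded below: F(w) ≥ F_min for all w ∈ E. Fix reals ε > 0, V ≥ 0 and a step size η > 0 with ηLV² < 2ε. Let x : ℕ → E and d : ℕ → E be sequences such that for every k: x_{k+1} = x_k − η·d_k, ⟨∇F(x_k), d_k⟩ ≥ ε‖∇F(x_k)‖², and ‖d_k‖² ≤ V²‖∇F(x_k)‖². Then the Cesàro averages (1/T)·∑_{k=0}^{T−1} ‖∇F(x_k)‖² converge to 0 as T → ∞. -/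
open RealInnerProductSpace Finset Filter

/-- One gradient-like step decreases an `L`-smooth function by a multiple of the squared gradient
norm. -/
theorem smooth_step_descent {E : Type*} [NormedAddCommGroup E] [InnerProductSpace ℝ E]
    {F : E → ℝ} {F' : E → E} {L : ℝ} (hL : 0 ≤ L)
    (hsmooth : ∀ v w : E, F v ≤ F w + ⟪F' w, v - w⟫ + L / 2 * ‖v - w‖ ^ 2)
    {ε V η : ℝ} (hη : 0 ≤ η) {w d : E}
    (halign : ε * ‖F' w‖ ^ 2 ≤ ⟪F' w, d⟫) (hdis : ‖d‖ ^ 2 ≤ V ^ 2 * ‖F' w‖ ^ 2) :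
    F (w - η • d) ≤ F w - η / 2 * (2 * ε - η * L * V ^ 2) * ‖F' w‖ ^ 2 := by
  have h := hsmooth (w - η • d) w
  rw [sub_sub_cancel_left, inner_neg_right, real_inner_smul_right, norm_neg, norm_smul, mul_pow,
    Real.norm_eq_abs, sq_abs] at h
  have h₁ := mul_le_mul_of_nonneg_left halign hη
  have h₂ := mul_le_mul_of_nonneg_left hdis (by positivity : 0 ≤ L / 2 * η ^ 2)
  linarith

/-- Averages of a sequence with bounded partial sums tend to zero. -/
theorem tendsto_average_of_sum_range_le {g : ℕ → ℝ} (hg : ∀ k, 0 ≤ g k) {C : ℝ}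
    (hC : ∀ T, ∑ k ∈ Finset.range T, g k ≤ C) :
    Tendsto (fun T : ℕ => (1 / (T : ℝ)) * ∑ k ∈ Finset.range T, g k) atTop (nhds 0) := by
  have hlim : Tendsto (fun T : ℕ => (1 / (T : ℝ)) * C) atTop (nhds 0) := by
    simpa using (tendsto_one_div_atTop_nhds_zero_nat (𝕜 := ℝ)).mul_const C
  refine squeeze_zero (fun T => ?_) (fun T => ?_) hlim
  · exact mul_nonneg (by positivity) (Finset.sum_nonneg fun k _ => hg k)
  · exact mul_le_mul_of_nonneg_left (hC T) (by positivity)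

/-- Convergence of the Cesàro averages of squared gradient norms for the DMS iteration. -/
theorem dms_cesaro_convergence
    {E : Type*} [NormedAddCommGroup E] [InnerProductSpace ℝ E]
    (F : E → ℝ) (F' : E → E) (L : ℝ) (hL : 0 < L)
    (hdiff : ∀ x : E, HasFDerivAt F (innerSL ℝ (F' x)) x)
    (hsmooth : ∀ v w : E, F v ≤ F w + ⟪F' w, v - w⟫ + L / 2 * ‖v - w‖ ^ 2)
    (Fmin : ℝ) (hbdd : ∀ w : E, Fmin ≤ F w)
    (ε V η : ℝ) (hε : 0 < ε) (hV : 0 ≤ V) (hη : 0 < η)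
    (hstep : η * L * V ^ 2 < 2 * ε)
    (x d : ℕ → E)
    (hx : ∀ k : ℕ, x (k + 1) = x k - η • d k)
    (halign : ∀ k : ℕ, ε * ‖F' (x k)‖ ^ 2 ≤ ⟪F' (x k), d k⟫)
    (hdis : ∀ k : ℕ, ‖d k‖ ^ 2 ≤ V ^ 2 * ‖F' (x k)‖ ^ 2) :
    Tendsto (fun T : ℕ => (1 / (T : ℝ)) * ∑ k ∈ Finset.range T, ‖F' (x k)‖ ^ 2)
      atTop (nhds 0) := by
  have hc : 0 < η / 2 * (2 * ε - η * L * V ^ 2) :=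
    mul_pos (half_pos hη) (sub_pos.2 hstep)
  set c := η / 2 * (2 * ε - η * L * V ^ 2) with hc_def
  have hdescent (k : ℕ) : c * ‖F' (x k)‖ ^ 2 ≤ F (x k) - F (x (k + 1)) := by
    have h := smooth_step_descent hL.le hsmooth hη.le (halign k) (hdis k)
    rw [← hx k, ← hc_def] at h
    linarith
  refine tendsto_average_of_sum_range_le (C := (F (x 0) - Fmin) / c)
    (fun k => sq_nonneg _) fun T => ?_
  rw [le_div_iff₀' hc, Finset.mul_sum]
  calc ∑ k ∈ Finset.range T, c * ‖F' (x k)‖ ^ 2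
      ≤ ∑ k ∈ Finset.range T, (F (x k) - F (x (k + 1))) :=
        Finset.sum_le_sum fun k _ => hdescent k
    _ = F (x 0) - F (x T) := Finset.sum_range_sub' (fun k => F (x k)) T
    _ ≤ F (x 0) - Fmin := sub_le_sub_left (hbdd _) _
end
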